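/- arXiv:2209.05737 — 2 statements merged into one kernel-verified Lean document; each statement's English description precedes it below -/
import Mathlib

section
/- Up to simplicial isomorphism, there are exactly two triangulations of the 2-sphere with 6 vertices: the octahedron and the stacked triangulation obtained from the bipyramid by subdividing one edge. -/
open Finset

/-- The edges (2-element vertex subsets contained in some face) of a face set `F`. -/
def triEdges (n : ℕ) (F : Finset (Finset (Fin n))) : Finset (Finset (Fin n)) :=
  (Finset.powersetCard 2 Finset.univ).filter (fun e => ∃ f ∈ F, e ⊆ f)

/-- Degree of a vertex: the number of edges containing it. -/
def triDegree (n : ℕ) (F : Finset (Finset (Fin n))) (v : Fin n) : ℕ :=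
  ((triEdges n F).filter (fun e => v ∈ e)).card

/-- `F` is the face set of a triangulation of the 2-sphere on the vertex set `Fin n`:
every face is a triangle, every vertex lies in a face, every edge lies in exactly
two faces, the link of every vertex is connected (hence, being 2-regular, a cycle),
the 1-skeleton is connected, and the Euler characteristic is 2 (so the underlying
closed surface is the 2-sphere). -/
def IsSphereTriangulation (n : ℕ) (F : Finset (Finset (Fin n))) : Prop :=
  (∀ f ∈ F, f.card = 3) ∧
  (∀ v : Fin n, ∃ f ∈ F, v ∈ f) ∧
  (∀ e : Finset (Fin n), e.card = 2 → (∃ f ∈ F, e ⊆ f) →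
      (F.filter (fun f => e ⊆ f)).card = 2) ∧
  (∀ v a b : Fin n, (∃ f ∈ F, v ∈ f ∧ a ∈ f) → (∃ f ∈ F, v ∈ f ∧ b ∈ f) →
      a ≠ v → b ≠ v →
      Relation.ReflTransGen (fun x y => ({v, x, y} : Finset (Fin n)) ∈ F) a b) ∧
  (∀ a b : Fin n, Relation.ReflTransGen (fun x y => ∃ f ∈ F, x ∈ f ∧ y ∈ f) a b) ∧
  ((n : ℤ) - ((triEdges n F).card : ℤ) + (F.card : ℤ) = 2)

/-- Simplicial isomorphism of two face sets on `Fin n`. -/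
def TriIso (n : ℕ) (F F' : Finset (Finset (Fin n))) : Prop :=
  ∃ σ : Equiv.Perm (Fin n), F.image (fun f => f.image σ) = F'

/-- A face-rainbow 3-edge-coloring: every triangular face has its three
boundary edges colored with three pairwise distinct colors. -/
def Rainbow (n : ℕ) (F : Finset (Finset (Fin n))) (c : Finset (Fin n) → Fin 3) : Prop :=
  ∀ f ∈ F, ∀ a ∈ f, ∀ b ∈ f, ∀ d ∈ f, a ≠ b → a ≠ d → b ≠ d →
    c {a, b} ≠ c {a, d}

/-- Two edge-colorings are equivalent if they differ by a permutation of the colors. -/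
def ColorEquiv (n : ℕ) (F : Finset (Finset (Fin n)))
    (c c' : Finset (Fin n) → Fin 3) : Prop :=
  ∃ π : Equiv.Perm (Fin 3), ∀ e ∈ triEdges n F, c' e = π (c e)

/-- The degree sequence (as a multiset) of a triangulation. -/
def degSeq (n : ℕ) (F : Finset (Finset (Fin n))) : Multiset ℕ :=
  (Finset.univ.val : Multiset (Fin n)).map (triDegree n F)

def octaFaces : Finset (Finset (Fin 6)) :=
  {({0,1,2} : Finset (Fin 6)), {0,1,5}, {0,2,4}, {0,4,5}, {1,2,3}, {1,3,5}, {2,3,4}, {3,4,5}}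
/-- The stacked 6-vertex triangulation `G_{6,2}`: the bipyramid over `{0,1,2}`
with apexes `3,4`, with the edge `{3,0}` subdivided by the new vertex `5`.
Its degree sequence is `(5,5,4,4,3,3)`. -/
def G62Faces : Finset (Finset (Fin 6)) :=
  {({5,0,1} : Finset (Fin 6)), {5,3,1}, {5,0,2}, {5,3,2}, {3,1,2}, {4,0,1}, {4,1,2}, {4,0,2}}

/-- Points at distance at most two are related by the reflexive transitive closure. -/
theorem reflTransGen_of_two_steps {α : Type*} {r : α → α → Prop} {a b : α}
    (h : ∃ c, (a = c ∨ r a c) ∧ (c = b ∨ r c b)) : Relation.ReflTransGen r a b := by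
  obtain ⟨c, rfl | hac, rfl | hcb⟩ := h
  · exact .refl
  · exact .single hcb
  · exact .single hac
  · exact .tail (.single hac) hcb

set_option maxRecDepth 20000 in
set_option synthInstance.maxSize 1000 in
theorem isSphereTriangulation_octaFaces : IsSphereTriangulation 6 octaFaces := by
  refine ⟨by decide, by decide, by decide,
    fun v a b ha hb hav hbv => reflTransGen_of_two_steps ?_,
    fun a b => reflTransGen_of_two_steps ?_, by decide⟩
  · revert v a b; decide
  · revert a b; decide

set_option maxRecDepth 20000 in
set_option synthInstance.maxSize 1000 in
theorem isSphereTriangulation_G62Faces : IsSphereTriangulation 6 G62Faces := by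
  refine ⟨by decide, by decide, by decide,
    fun v a b ha hb hav hbv => reflTransGen_of_two_steps ?_,
    fun a b => reflTransGen_of_two_steps ?_, by decide⟩
  · revert v a b; decide
  · revert a b; decide

theorem not_triIso_octaFaces_G62Faces : ¬ TriIso 6 octaFaces G62Faces := by
  rintro ⟨σ, hσ⟩
  have hG : (G62Faces.filter (fun f => 3 ∈ f)).card = 3 := by decide
  have hO : ∀ v : Fin 6, (octaFaces.filter (fun f => v ∈ f)).card = 4 := by decide
  have hinj : Function.Injective fun f : Finset (Fin 6) => f.image σ :=
    Finset.image_injective σ.injective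
  rw [← hσ, Finset.filter_image, Finset.card_image_of_injective _ hinj] at hG
  have := hO (σ.symm 3)
  simp only [Finset.mem_image, ← Equiv.eq_symm_apply, exists_eq_right] at hG
  omega

/-- Each triangle has three edges and each edge lies in two triangles, so Euler's formula
determines the number of faces. -/
theorem IsSphereTriangulation.card_eq {n : ℕ} {F : Finset (Finset (Fin n))}
    (h : IsSphereTriangulation n F) : F.card + 4 = 2 * n := by
  obtain ⟨h3, -, h2, -, -, hE⟩ := h
  have key := Finset.sum_card_bipartiteAbove_eq_sum_card_bipartiteBelow
    (s := triEdges n F) (t := F) (fun e f => e ⊆ f)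
  have hl : ∀ e ∈ triEdges n F, (F.bipartiteAbove (fun e f => e ⊆ f) e).card = 2 := by
    intro e he
    simp only [triEdges, Finset.mem_filter, Finset.mem_powersetCard_univ] at he
    exact h2 e he.1 he.2
  have hr : ∀ f ∈ F, ((triEdges n F).bipartiteBelow (fun e f => e ⊆ f) f).card = 3 := by
    intro f hf
    have : (triEdges n F).bipartiteBelow (fun e f => e ⊆ f) f = Finset.powersetCard 2 f := by
      ext e
      simp only [triEdges, Finset.bipartiteBelow, Finset.mem_filter,
        Finset.mem_powersetCard]
      exact ⟨fun he => ⟨he.2, he.1.1.2⟩,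
        fun he => ⟨⟨⟨Finset.subset_univ e, he.2⟩, f, hf, he.1⟩, he.1⟩⟩
    rw [this, Finset.card_powersetCard, h3 f hf]; rfl
  rw [Finset.sum_const_nat hl, Finset.sum_const_nat hr] at key
  omega

/-- Whether all vertices satisfy `p`; unlike the general decision procedure, this evaluates
quickly in the kernel. -/
def allV (p : Fin 6 → Bool) : Bool :=
  p ⟨0, by decide⟩ && (p ⟨1, by decide⟩ && (p ⟨2, by decide⟩ && (p ⟨3, by decide⟩ &&
    (p ⟨4, by decide⟩ && p ⟨5, by decide⟩))))

/-- Whether some vertex satisfies `p`. -/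
def anyV (p : Fin 6 → Bool) : Bool :=
  p ⟨0, by decide⟩ || (p ⟨1, by decide⟩ || (p ⟨2, by decide⟩ || (p ⟨3, by decide⟩ ||
    (p ⟨4, by decide⟩ || p ⟨5, by decide⟩))))

/-- The number of vertices satisfying `p`. -/
def countV (p : Fin 6 → Bool) : ℕ :=
  (p ⟨0, by decide⟩).toNat + (p ⟨1, by decide⟩).toNat + (p ⟨2, by decide⟩).toNat +
    (p ⟨3, by decide⟩).toNat + (p ⟨4, by decide⟩).toNat + (p ⟨5, by decide⟩).toNat

theorem allV_eq_true {p : Fin 6 → Bool} : allV p = true ↔ ∀ v, p v = true := by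
  simp [allV, Fin.forall_fin_succ]

theorem anyV_eq_true {p : Fin 6 → Bool} : anyV p = true ↔ ∃ v, p v = true := by
  simp [anyV, Fin.exists_fin_succ]

theorem countV_eq_card (p : Fin 6 → Bool) :
    countV p = (Finset.univ.filter fun v => p v = true).card := by
  rw [Finset.card_filter, Fin.sum_univ_six]
  have hp : ∀ v, (if p v = true then 1 else 0) = (p v).toNat := fun v => by cases p v <;> rfl
  simp only [hp]
  rfl

/-- The digit of `M` at position `s`, evaluating faster than `Nat.testBit`. -/
def digit (M s : ℕ) : Bool := Nat.beq (M >>> s &&& 1) 1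

theorem digit_eq_testBit (M s : ℕ) : digit M s = M.testBit s := by
  rw [digit, Nat.testBit, Nat.and_comm, Nat.one_and_eq_mod_two]
  rcases Nat.mod_two_eq_zero_or_one (M >>> s) with h | h <;> rw [h] <;> rfl

/-- The binary code of a vertex triple. -/
def triCode (a b c : Fin 6) : ℕ := 1 <<< a.val + 1 <<< b.val + 1 <<< c.val

/-- The vertex set with binary code `s`. -/
def decodeSet (s : ℕ) : Finset (Fin 6) := Finset.univ.filter fun v => s.testBit v

/-- The codes of the triangles avoiding the vertex `0`. -/
def baseTris : List ℕ := [14, 22, 26, 28, 38, 42, 44, 50, 52, 56]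

/-- The codes of the triangles containing the vertex `0`. -/
def coneTris : List ℕ := [7, 11, 13, 19, 21, 25, 35, 37, 41, 49]

/-- The number whose binary digits are `1` exactly at the members of `l` satisfying `p`. -/
def mask (p : ℕ → Bool) : List ℕ → ℕ
  | [] => 0
  | s :: l => mask p l ||| (p s).toNat <<< s

theorem testBit_mask (p : ℕ → Bool) (l : List ℕ) (s : ℕ) :
    (mask p l).testBit s = (decide (s ∈ l) && p s) := by
  induction l with
  | nil => simp [mask]
  | cons t l ih =>
    simp only [mask, Nat.testBit_or, ih, Nat.testBit_shiftLeft, List.mem_cons]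
    rcases lt_trichotomy s t with h | rfl | h
    · simp [h.ne, h]
    · cases p s <;> simp
    · have : s - t ≠ 0 := by omega
      cases hp : p t <;> simp [h.ne', h.le, Nat.testBit_one_eq_true_iff_self_eq_zero, this]

theorem mask_congr {p q : ℕ → Bool} {l : List ℕ} (h : ∀ s ∈ l, p s = q s) :
    mask p l = mask q l := by
  refine Nat.eq_of_testBit_eq fun s => ?_
  rw [testBit_mask, testBit_mask]
  by_cases hs : s ∈ l <;> simp [hs, h]

theorem mask_append (p : ℕ → Bool) (l l' : List ℕ) :
    mask p (l ++ l') = mask p l ||| mask p l' := by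
  refine Nat.eq_of_testBit_eq fun s => ?_
  simp only [Nat.testBit_or, testBit_mask, List.mem_append, Bool.decide_or,
    Bool.and_or_distrib_right]

/-- Whether `Q` holds at `m` with an arbitrary set of the digits listed in `l` set to `1`. -/
def allMasks (Q : ℕ → Bool) : List ℕ → ℕ → Bool
  | [], m => Q m
  | s :: l, m => allMasks Q l m && allMasks Q l (m ||| 1 <<< s)

theorem of_allMasks {Q : ℕ → Bool} {l : List ℕ} {m : ℕ} (h : allMasks Q l m = true)
    (p : ℕ → Bool) : Q (m ||| mask p l) = true := by
  induction l generalizing m with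
  | nil => simpa [mask, allMasks] using h
  | cons s l ih =>
    simp only [allMasks, Bool.and_eq_true] at h
    cases hp : p s
    · simpa [mask, hp] using ih h.1
    · have h' := ih h.2
      rw [Nat.or_assoc, Nat.or_comm (1 <<< s)] at h'
      simpa [mask, hp] using h'

/-- Whether the face set with code `M` contains the triangle `abc`. -/
def hasTri (M : ℕ) (a b c : Fin 6) : Bool := digit M (triCode a b c)

/-- Every edge lies in no or two faces, every vertex lies in a face, and some pair of
vertices is not an edge. -/
def admissible (M : ℕ) : Bool :=
  (allV fun a => allV fun b => Nat.ble a.val b.val ||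
    (Nat.beq (countV (hasTri M a b)) 0 || Nat.beq (countV (hasTri M a b)) 2)) &&
  ((allV fun a => anyV fun b => anyV fun c => hasTri M a b c) &&
  (anyV fun a => anyV fun b => !Nat.beq a.val b.val && allV fun c => !hasTri M a b c))

/-- Whether the octahedron embeds in the face set with code `M`, its vertex `0` being fixed. -/
def containsOcta (M : ℕ) : Bool :=
  anyV fun b => anyV fun c => hasTri M 0 b c && anyV fun f => hasTri M 0 b f &&
    anyV fun e => hasTri M 0 c e && (hasTri M 0 e f && anyV fun d => hasTri M b c d &&
      (hasTri M b d f && (hasTri M c d e && (hasTri M d e f &&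
        decide (Function.Injective ![0, b, c, d, e, f])))))

/-- Whether `G62Faces` embeds in the face set with code `M`; the conditions on the order of the
vertices use the symmetries of `G62Faces` to shorten the search. -/
def containsG62 (M : ℕ) : Bool :=
  anyV fun b => anyV fun c => Nat.blt b.val c.val && anyV fun d => hasTri M d b c &&
    anyV fun e => hasTri M e b c && (Nat.blt d.val e.val && anyV fun a => hasTri M e a b &&
      (hasTri M e a c && anyV fun f => hasTri M f a b && (hasTri M f a c && (hasTri M f d b &&
        (hasTri M f d c && decide (Function.Injective ![a, b, c, d, e, f]))))))

/-- Adds to a set of triangles avoiding `0` those triangles `0ab` for which `ab` lies in an odd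
number of members of the set. -/
def cone (K : ℕ) : ℕ :=
  mask (fun s => Nat.beq (countV (fun v => digit K (s - 1 + 1 <<< v.val)) &&& 1) 1) coneTris ||| K

theorem allMasks_classification :
    allMasks (fun K => !admissible (cone K) || (containsG62 (cone K) || containsOcta (cone K)))
      baseTris 0 = true := by
  decide +kernel

theorem triIso_of_forall_image_mem {n : ℕ} {F G : Finset (Finset (Fin n))} {τ : Fin n → Fin n}
    (hτ : Function.Injective τ) (hG : ∀ g ∈ G, g.image τ ∈ F) (hFG : F.card ≤ G.card) :
    TriIso n F G := by
  have hF : G.image (fun g => g.image τ) = F := by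
    refine Finset.eq_of_subset_of_card_le (Finset.image_subset_iff.2 hG) ?_
    rwa [Finset.card_image_of_injective _ (Finset.image_injective hτ)]
  let e := Equiv.ofBijective τ (Finite.injective_iff_bijective.1 hτ)
  refine ⟨e.symm, ?_⟩
  have he : ∀ x, e.symm (τ x) = x := e.symm_apply_apply
  rw [← hF, Finset.image_image]
  simp [Function.comp_def, Finset.image_image, he]

theorem triIso_octaFaces_of_containsOcta {F : Finset (Finset (Fin 6))} {M : ℕ}
    (hM : ∀ a b c, hasTri M a b c = true → {a, b, c} ∈ F) (hF : F.card = 8)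
    (h : containsOcta M = true) : TriIso 6 F octaFaces := by
  simp only [containsOcta, anyV_eq_true, Bool.and_eq_true, decide_eq_true_eq] at h
  obtain ⟨b, c, h₁, f, h₂, e, h₃, h₄, d, h₅, h₆, h₇, h₈, hinj⟩ := h
  refine triIso_of_forall_image_mem hinj ?_ (hF.trans_le (by decide))
  simp only [octaFaces, Finset.forall_mem_insert, Finset.mem_singleton, forall_eq,
    Finset.image_insert, Finset.image_singleton]
  exact ⟨hM _ _ _ h₁, hM _ _ _ h₂, hM _ _ _ h₃, hM _ _ _ h₄, hM _ _ _ h₅, hM _ _ _ h₆,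
    hM _ _ _ h₇, hM _ _ _ h₈⟩

theorem triIso_G62Faces_of_containsG62 {F : Finset (Finset (Fin 6))} {M : ℕ}
    (hM : ∀ a b c, hasTri M a b c = true → {a, b, c} ∈ F) (hF : F.card = 8)
    (h : containsG62 M = true) : TriIso 6 F G62Faces := by
  simp only [containsG62, anyV_eq_true, Bool.and_eq_true, decide_eq_true_eq] at h
  obtain ⟨b, c, -, d, h₅, e, h₇, -, a, h₆, h₈, f, h₁, h₂, h₃, h₄, hinj⟩ := h
  refine triIso_of_forall_image_mem hinj ?_ (hF.trans_le (by decide))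
  simp only [G62Faces, Finset.forall_mem_insert, Finset.mem_singleton, forall_eq,
    Finset.image_insert, Finset.image_singleton]
  exact ⟨hM _ _ _ h₁, hM _ _ _ h₃, hM _ _ _ h₂, hM _ _ _ h₄, hM _ _ _ h₅, hM _ _ _ h₆,
    hM _ _ _ h₇, hM _ _ _ h₈⟩

/-- The code of the set of those members of `F` whose own codes are listed in `l`. -/
def faceCode (F : Finset (Finset (Fin 6))) (l : List ℕ) : ℕ :=
  mask (fun s => decide (decodeSet s ∈ F)) l

theorem hasTri_faceCode {F : Finset (Finset (Fin 6))} (h3 : ∀ f ∈ F, f.card = 3)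
    (a b c : Fin 6) :
    hasTri (faceCode F (coneTris ++ baseTris)) a b c = decide ({a, b, c} ∈ F) := by
  have hmem : ∀ a b c : Fin 6, triCode a b c ∈ coneTris ++ baseTris →
      decodeSet (triCode a b c) = {a, b, c} := by decide +kernel
  have hnot : ∀ a b c : Fin 6, triCode a b c ∉ coneTris ++ baseTris →
      ({a, b, c} : Finset (Fin 6)).card ≠ 3 := by decide +kernel
  rw [hasTri, digit_eq_testBit, faceCode, testBit_mask]
  by_cases h : triCode a b c ∈ coneTris ++ baseTris
  · simp only [h, hmem a b c h, decide_true, Bool.true_and]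
  · simp only [h, decide_false, Bool.false_and]
    exact (decide_eq_false fun hf => hnot a b c h (h3 _ hf)).symm

/-- The faces containing the edge `ab` correspond to the vertices opposite to it. -/
theorem card_filter_pair_subset {n : ℕ} {F : Finset (Finset (Fin n))}
    (h3 : ∀ f ∈ F, f.card = 3) {a b : Fin n} (hab : a ≠ b) :
    (F.filter fun f => {a, b} ⊆ f).card =
      (Finset.univ.filter fun c : Fin n => {a, b, c} ∈ F).card := by
  symm
  have hne : ∀ c, {a, b, c} ∈ F → c ≠ a ∧ c ≠ b := by
    intro c hc
    have := h3 _ hc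
    constructor <;> rintro rfl
    · rw [Finset.pair_comm b c, Finset.insert_eq_of_mem (by simp), Finset.card_pair hab] at this
      omega
    · rw [Finset.pair_eq_singleton, Finset.card_pair hab] at this
      omega
  refine Finset.card_bij (fun c _ => {a, b, c}) ?_ ?_ ?_
  · intro c hc
    simp only [Finset.mem_filter, Finset.mem_univ, true_and] at hc ⊢
    exact ⟨hc, by intro x; simp; tauto⟩
  · intro c hc c' hc' h
    simp only [Finset.mem_filter, Finset.mem_univ, true_and] at hc hc'
    have : c ∈ ({a, b, c'} : Finset (Fin n)) := h ▸ by simp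
    simpa [hne c hc] using this
  · intro f hf
    simp only [Finset.mem_filter] at hf
    obtain ⟨c, hc⟩ : ∃ c, f \ {a, b} = {c} := by
      rw [← Finset.card_eq_one, Finset.card_sdiff_of_subset hf.2, h3 f hf.1, Finset.card_pair hab]
    have : {a, b, c} = f := by
      rw [← Finset.union_sdiff_of_subset hf.2, hc]
      ext x; simp
    exact ⟨c, by simpa [this] using hf.1, this⟩

/-- In a closed surface every pair of vertices lies in no or two faces. -/
theorem countV_hasTri_faceCode {F : Finset (Finset (Fin 6))} (hF : IsSphereTriangulation 6 F)
    {a b : Fin 6} (hab : a ≠ b) :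
    countV (hasTri (faceCode F (coneTris ++ baseTris)) a b) = 0 ∨
      countV (hasTri (faceCode F (coneTris ++ baseTris)) a b) = 2 := by
  simp only [countV_eq_card, hasTri_faceCode hF.1, decide_eq_true_eq]
  rw [← card_filter_pair_subset hF.1 hab]
  by_cases h : ∃ f ∈ F, {a, b} ⊆ f
  · exact .inr (hF.2.2.1 _ (Finset.card_pair hab) h)
  · left
    rw [Finset.card_eq_zero, Finset.filter_eq_empty_iff]
    exact fun f hf hs => h ⟨f, hf, hs⟩

/-- A triangulation with six vertices has twelve edges, so two vertices are not adjacent. -/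
theorem exists_not_adj {F : Finset (Finset (Fin 6))} (hF : IsSphereTriangulation 6 F) :
    ∃ a b : Fin 6, a ≠ b ∧ ∀ c, {a, b, c} ∉ F := by
  have hcard : (triEdges 6 F).card <
      (Finset.powersetCard 2 (Finset.univ : Finset (Fin 6))).card := by
    have h8 := hF.card_eq
    have hE := hF.2.2.2.2.2
    have h15 : (Finset.powersetCard 2 (Finset.univ : Finset (Fin 6))).card = 15 := by decide
    omega
  obtain ⟨e, he, hne⟩ := Finset.exists_mem_notMem_of_card_lt_card hcard
  obtain ⟨a, b, hab, rfl⟩ := Finset.card_eq_two.1 (Finset.mem_powersetCard.1 he).2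
  refine ⟨a, b, hab, fun c hc => hne (Finset.mem_filter.2 ⟨he, _, hc, ?_⟩)⟩
  intro x; simp; tauto

theorem admissible_faceCode {F : Finset (Finset (Fin 6))} (hF : IsSphereTriangulation 6 F) :
    admissible (faceCode F (coneTris ++ baseTris)) = true := by
  simp only [admissible, Bool.and_eq_true, allV_eq_true, anyV_eq_true, Bool.or_eq_true,
    Nat.beq_eq, Nat.ble_eq, Bool.not_eq_true', Bool.eq_false_iff, ne_eq, Fin.val_inj,
    hasTri_faceCode hF.1, decide_eq_true_eq]
  refine ⟨fun a b => ?_, fun a => ?_, exists_not_adj hF⟩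
  · by_cases hab : a = b
    · exact .inl (by rw [hab])
    · exact .inr (countV_hasTri_faceCode hF hab)
  · obtain ⟨f, hf, haf⟩ := hF.2.1 a
    have h2 : (f.erase a).card = 2 := by rw [Finset.card_erase_of_mem haf, hF.1 f hf]
    obtain ⟨b, c, -, hbc⟩ := Finset.card_eq_two.1 h2
    exact ⟨b, c, by rwa [← hbc, Finset.insert_erase haf]⟩

/-- The faces at the vertex `0` are determined by the others. -/
theorem faceCode_eq_cone {F : Finset (Finset (Fin 6))} (hF : IsSphereTriangulation 6 F) :
    faceCode F (coneTris ++ baseTris) = cone (faceCode F baseTris) := by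
  rw [faceCode, mask_append, cone]
  refine congrArg (· ||| _) (mask_congr fun s hs => ?_)
  have hpair : ∀ s ∈ coneTris, ∃ a b : Fin 6, a ≠ 0 ∧ b ≠ 0 ∧ a ≠ b ∧ s = triCode a b 0 ∧
      decodeSet s = {a, b, 0} := by decide +kernel
  have hbase : ∀ a b c : Fin 6, a ≠ 0 → b ≠ 0 → c ≠ 0 →
      (triCode a b c ∈ coneTris ++ baseTris ↔ triCode a b c ∈ baseTris) := by decide +kernel
  have hzero : ∀ a b : Fin 6, a ≠ 0 → b ≠ 0 → triCode a b 0 ∉ baseTris := by decide +kernel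
  obtain ⟨a, b, ha, hb, hab, rfl, hdec⟩ := hpair s hs
  have hK : (fun c : Fin 6 => digit (faceCode F baseTris) (triCode a b 0 - 1 + 1 <<< c.val)) =
      fun c => if c = 0 then false else hasTri (faceCode F (coneTris ++ baseTris)) a b c := by
    funext c
    have : triCode a b 0 - 1 + 1 <<< c.val = triCode a b c := by simp [triCode]
    simp only [this, hasTri, faceCode, digit_eq_testBit, testBit_mask]
    split_ifs with hc
    · simp [hc, hzero a b ha hb]
    · simp only [hbase a b c ha hb hc]
  have hcount := countV_hasTri_faceCode hF hab
  have h0 : hasTri (faceCode F (coneTris ++ baseTris)) a b 0 = decide ({a, b, 0} ∈ F) :=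
    hasTri_faceCode hF.1 a b 0
  rw [hK, hdec, ← h0, Bool.eq_iff_iff, Nat.beq_eq, Nat.and_one_is_mod]
  simp only [countV, Fin.zero_eta, Fin.mk_one, Fin.reduceFinMk, Fin.reduceEq, if_true,
    if_false, one_ne_zero, Bool.toNat_false] at hcount ⊢
  have htoNat : ∀ t : Bool, t = true ↔ t.toNat = 1 := by decide
  rw [htoNat]
  have := Bool.toNat_le (hasTri (faceCode F (coneTris ++ baseTris)) a b 0)
  omega

/-- Up to simplicial isomorphism there are exactly two triangulations of the
2-sphere with `6` vertices: the octahedron and the stacked triangulation obtained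
from the bipyramid by subdividing one equatorial edge. -/
theorem two_sphere_triangulations_six_vertices :
    IsSphereTriangulation 6 octaFaces ∧ IsSphereTriangulation 6 G62Faces ∧
      ¬ TriIso 6 octaFaces G62Faces ∧
      ∀ F : Finset (Finset (Fin 6)), IsSphereTriangulation 6 F →
        TriIso 6 F octaFaces ∨ TriIso 6 F G62Faces := by
  refine ⟨isSphereTriangulation_octaFaces, isSphereTriangulation_G62Faces,
    not_triIso_octaFaces_G62Faces, fun F hF => ?_⟩
  have hM : ∀ a b c, hasTri (faceCode F (coneTris ++ baseTris)) a b c = true → {a, b, c} ∈ F :=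
    fun a b c h => by simpa [hasTri_faceCode hF.1] using h
  have hcard : F.card = 8 := by have := hF.card_eq; omega
  have h := of_allMasks allMasks_classification fun s => decide (decodeSet s ∈ F)
  rw [← faceCode, Nat.zero_or, ← faceCode_eq_cone hF, admissible_faceCode hF, Bool.not_true,
    Bool.false_or, Bool.or_eq_true] at h
  exact h.symm.imp (triIso_octaFaces_of_containsOcta hM hcard)
    (triIso_G62Faces_of_containsG62 hM hcard)
end

section
/- Up to simplicial isomorphism, there are exactly five triangulations of the 2-sphere with 7 vertices. -/
open Finset

/-- The pairs of vertices in lexicographic order. -/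
def vertexPairs : List (Fin 7 × Fin 7) :=
  (List.finRange 7).flatMap fun a => ((List.finRange 7).filter (a < ·)).map (a, ·)

/-- The number of faces in a list that contain two given vertices. -/
def pairCount (A : List (Finset (Fin 7))) (e : Fin 7 × Fin 7) : ℕ :=
  A.countP fun f => e.1 ∈ f ∧ e.2 ∈ f

/-- Five lists of ten faces; the cone over a hexagon or a pentagon comes first. -/
def modelFaces : Fin 5 → List (Finset (Fin 7)) :=
  ![[{0,1,2},{0,2,3},{0,3,4},{0,4,5},{0,5,6},{0,1,6},{1,2,3},{1,3,4},{1,4,5},{1,5,6}],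
    [{0,1,2},{0,2,3},{0,3,4},{0,4,5},{0,5,6},{0,1,6},{1,2,6},{2,3,6},{3,5,6},{3,4,5}],
    [{0,1,2},{0,2,3},{0,3,4},{0,4,5},{0,5,6},{0,1,6},{1,2,3},{3,4,5},{1,5,6},{1,3,5}],
    [{0,1,2},{0,2,3},{0,3,4},{0,4,5},{0,1,5},{1,2,6},{2,3,6},{3,4,6},{4,5,6},{1,5,6}],
    [{0,1,2},{0,2,3},{0,3,4},{0,4,5},{0,1,5},{1,2,3},{1,3,6},{3,4,6},{4,5,6},{1,5,6}]]

/-- The number of faces in a list that contain a given vertex. -/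
def faceCount (A : List (Finset (Fin 7))) (v : Fin 7) : ℕ :=
  A.countP fun f => v ∈ f

/-- Whether the assignment `l` of images to all seven vertices is an isomorphism of face lists. -/
def checkImages (A B : List (Finset (Fin 7))) (l : List (Fin 7)) : Bool :=
  l.Nodup ∧ l.length = 7 ∧ ∀ f ∈ A, f.image (fun v => l.getD v.val 0) ∈ B

/-- Backtracking search for an isomorphism that preserves face counts of vertices,
given the images `l` of the first vertices. The list `vs` holds the other vertices. -/
def searchIso (A B : List (Finset (Fin 7))) : List (Fin 7) → List (Fin 7) → Bool
  | [], l => checkImages A B l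
  | v :: vs, l => (List.finRange 7).any fun w =>
      w ∉ l && faceCount A v == faceCount B w && searchIso A B vs (l ++ [w])

/-- Whether a list of faces is isomorphic to one of the five models,
unless it does not have ten faces or does not cover all vertices. -/
def checkClosed (A : List (Finset (Fin 7))) : Bool :=
  A.length != 10 || !((List.finRange 7).all fun v => faceCount A v != 0) ||
    (List.finRange 5).any fun i => searchIso A (modelFaces i) (List.finRange 7) []

/-- Add faces to `A` at a boundary edge in all possible ways, at most `n` of them,
and check the closed face lists obtained. The vertices in use are those below `k`. -/
def searchFaces : ℕ → ℕ → List (Finset (Fin 7)) → Bool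
  | n, k, A =>
    match vertexPairs.find? (pairCount A · == 1) with
    | none => checkClosed A
    | some e =>
      match n with
      | 0 => true
      | n + 1 => (List.finRange 7).all fun y =>
          k < y.val || y == e.1 || y == e.2 || ({e.1, e.2, y} : Finset (Fin 7)) ∈ A ||
            vertexPairs.any (2 < pairCount ({e.1, e.2, y} :: A) ·) ||
            searchFaces n (if y.val = k then k + 1 else k) ({e.1, e.2, y} :: A)

theorem three_mul_card_eq_two_mul_card_triEdges {n : ℕ} {F : Finset (Finset (Fin n))}
    (h3 : ∀ f ∈ F, f.card = 3)
    (h2 : ∀ e : Finset (Fin n), e.card = 2 → (∃ f ∈ F, e ⊆ f) →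
      (F.filter (fun f => e ⊆ f)).card = 2) :
    3 * F.card = 2 * (triEdges n F).card := by
  have key := Finset.sum_card_bipartiteAbove_eq_sum_card_bipartiteBelow
    (s := triEdges n F) (t := F) (fun e f => e ⊆ f)
  rw [Finset.sum_const_nat (m := 2), Finset.sum_const_nat (m := 3)] at key
  · omega
  · intro f hf
    have : (triEdges n F).bipartiteBelow (fun e f => e ⊆ f) f = f.powersetCard 2 := by
      ext e
      simp only [Finset.bipartiteBelow, triEdges, mem_filter, mem_powersetCard, subset_univ,
        true_and]
      constructor
      · rintro ⟨⟨h, -⟩, h'⟩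
        exact ⟨h', h⟩
      · rintro ⟨h', h⟩
        exact ⟨⟨h, f, hf, h'⟩, h'⟩
    rw [this, card_powersetCard, h3 f hf]
    rfl
  · intro e he
    simp only [triEdges, mem_filter, mem_powersetCard] at he
    exact h2 e he.1.2 he.2

/-- A nonempty set of faces that is closed under passing across edges contains all faces. -/
theorem IsSphereTriangulation.eq_of_edge_closed {n : ℕ} {F C : Finset (Finset (Fin n))}
    (hF : IsSphereTriangulation n F) (hCF : C ⊆ F) (hC : C.Nonempty)
    (hclosed : ∀ f ∈ C, ∀ g ∈ F, ∀ e : Finset (Fin n), e.card = 2 → e ⊆ f → e ⊆ g → g ∈ C) :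
    C = F := by
  obtain ⟨h3, -, -, hlink, hconn, -⟩ := hF
  have hstar : ∀ v, ∀ f ∈ C, v ∈ f → ∀ g ∈ F, v ∈ g → g ∈ C := by
    intro v f hf hvf g hg hvg
    have hcard : ∀ f ∈ F, v ∈ f → ∃ a ∈ f, a ≠ v := fun f hf hv =>
      Finset.exists_mem_ne (by rw [h3 f hf]; norm_num) v
    obtain ⟨a, haf, hav⟩ := hcard f (hCF hf) hvf
    obtain ⟨b, hbg, hbv⟩ := hcard g hg hvg
    have hpath := hlink v a b ⟨f, hCF hf, hvf, haf⟩ ⟨g, hg, hvg, hbg⟩ hav hbv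
    have hb : ∃ f ∈ C, v ∈ f ∧ b ∈ f ∧ b ≠ v := by
      clear hbv hbg
      induction hpath with
      | refl => exact ⟨f, hf, hvf, haf, hav⟩
      | @tail x y _ hxy ih =>
        obtain ⟨f', hf', hv', hx', hxv⟩ := ih
        refine ⟨{v, x, y}, hclosed f' hf' _ hxy {v, x} (card_pair hxv.symm) ?_ ?_, ?_, ?_, ?_⟩
        · simp [insert_subset_iff, hv', hx']
        · simp [insert_subset_iff]
        · simp
        · simp
        · rintro rfl
          have := h3 _ hxy
          have h : ({y, x, y} : Finset (Fin n)) = {y, x} := by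
            ext; simp; tauto
          rw [h, card_pair hxv.symm] at this
          omega
    obtain ⟨f', hf', hv', hb', -⟩ := hb
    exact hclosed f' hf' g hg {v, b} (card_pair hbv.symm)
      (by simp [insert_subset_iff, hv', hb']) (by simp [insert_subset_iff, hvg, hbg])
  refine hCF.antisymm fun g hg => ?_
  obtain ⟨f, hf⟩ := hC
  have hne : ∀ f ∈ F, f.Nonempty := fun f hf => card_pos.1 (by rw [h3 f hf]; norm_num)
  obtain ⟨a, ha⟩ := hne f (hCF hf)
  obtain ⟨b, hb⟩ := hne g hg
  have hb' : ∃ f ∈ C, b ∈ f := by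
    clear hb
    induction hconn a b with
    | refl => exact ⟨f, hf, ha⟩
    | tail _ hxy ih =>
      obtain ⟨f', hf', hx⟩ := ih
      obtain ⟨g', hg', hxg, hyg⟩ := hxy
      exact ⟨g', hstar _ f' hf' hx g' hg' hxg, hyg⟩
  obtain ⟨f', hf', hbf⟩ := hb'
  exact hstar b f' hf' hbf g hg hb

theorem searchIso_sound {A B : List (Finset (Fin 7))} {vs l : List (Fin 7)}
    (h : searchIso A B vs l = true) : ∃ l', checkImages A B l' = true := by
  induction vs generalizing l with
  | nil => exact ⟨l, h⟩
  | cons v vs ih =>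
    simp only [searchIso, List.any_eq_true, Bool.and_eq_true] at h
    obtain ⟨w, -, -, hw⟩ := h
    exact ih hw

theorem checkImages_sound {A B : List (Finset (Fin 7))} {l : List (Fin 7)}
    (h : checkImages A B l = true) :
    ∃ ρ : Equiv.Perm (Fin 7), ∀ f ∈ A, f.image ρ ∈ B := by
  simp only [checkImages, decide_eq_true_eq] at h
  obtain ⟨hnd, hlen, hB⟩ := h
  have hinj : Function.Injective fun v : Fin 7 => l.getD v.val 0 := by
    intro a b hab
    have ha : a.val < l.length := by omega
    have hb : b.val < l.length := by omega
    simp only [List.getD_eq_getElem _ _ ha, List.getD_eq_getElem _ _ hb] at hab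
    exact Fin.ext ((hnd.getElem_inj_iff).1 hab)
  exact ⟨Equiv.ofBijective _ (Finite.injective_iff_bijective.1 hinj), hB⟩

theorem checkClosed_sound {A : List (Finset (Fin 7))} (h : checkClosed A = true)
    (hlen : A.length = 10) (hcov : ∀ v : Fin 7, ∃ f ∈ A, v ∈ f) :
    ∃ i, ∃ ρ : Equiv.Perm (Fin 7), ∀ f ∈ A, f.image ρ ∈ modelFaces i := by
  have hall : ((List.finRange 7).all fun v => faceCount A v != 0) = true := by
    simpa [faceCount] using hcov
  simp only [checkClosed, hlen, hall, bne_self_eq_false, Bool.not_true, Bool.or_self,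
    Bool.false_or, List.any_eq_true] at h
  obtain ⟨i, -, hi⟩ := h
  obtain ⟨l, hl⟩ := searchIso_sound hi
  exact ⟨i, checkImages_sound hl⟩

theorem mem_vertexPairs {e : Fin 7 × Fin 7} : e ∈ vertexPairs ↔ e.1 < e.2 := by
  revert e
  decide

theorem image_image_perm_injective (σ : Equiv.Perm (Fin 7)) :
    Function.Injective fun f : Finset (Fin 7) => f.image σ :=
  Finset.image_injective σ.injective

theorem card_filter_image_eq_pairCount {A : List (Finset (Fin 7))} (hA : A.Nodup)
    (σ : Equiv.Perm (Fin 7)) (e : Fin 7 × Fin 7) :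
    ((A.toFinset.image (fun f => f.image σ)).filter
      (fun f => {σ e.1, σ e.2} ⊆ f)).card = pairCount A e := by
  rw [Finset.filter_image, Finset.card_image_of_injective _ (image_image_perm_injective σ),
    pairCount, List.countP_eq_length_filter, ← List.toFinset_card_of_nodup (hA.filter _),
    List.toFinset_filter]
  simp [insert_subset_iff]

theorem TriIso.of_perm {A : List (Finset (Fin 7))} {F G : Finset (Finset (Fin 7))}
    {σ ρ : Equiv.Perm (Fin 7)} (hσ : A.toFinset.image (fun f => f.image σ) = F)
    (hρ : A.toFinset.image (fun f => f.image ρ) = G) : TriIso 7 F G := by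
  refine ⟨σ.symm.trans ρ, ?_⟩
  subst hσ hρ
  simp [Finset.image_image, Function.comp_def]

theorem card_modelFaces (i : Fin 5) : (modelFaces i).toFinset.card = 10 := by
  revert i
  decide

theorem IsSphereTriangulation.card_eq_ten {F : Finset (Finset (Fin 7))}
    (hF : IsSphereTriangulation 7 F) : F.card = 10 := by
  have h := three_mul_card_eq_two_mul_card_triEdges hF.1 hF.2.2.1
  have := hF.2.2.2.2.2
  push_cast at this
  omega

theorem exists_triIso_of_checkClosed {F : Finset (Finset (Fin 7))} (hF : IsSphereTriangulation 7 F)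
    {A : List (Finset (Fin 7))} {σ : Equiv.Perm (Fin 7)}
    (hA : A.Nodup) (hne : A ≠ []) (hσ : ∀ f ∈ A, f.image σ ∈ F)
    (hclosed : ∀ e ∈ vertexPairs, pairCount A e ≠ 1) (hcheck : checkClosed A = true) :
    ∃ i, TriIso 7 F (modelFaces i).toFinset := by
  have hsub : A.toFinset.image (fun f => f.image σ) ⊆ F := by
    simpa [Finset.image_subset_iff] using hσ
  have himage : A.toFinset.image (fun f => f.image σ) = F := by
    refine hF.eq_of_edge_closed hsub ?_ ?_
    · simpa using hne
    · intro f hf g hg e he hef heg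
      obtain ⟨f₀, hf₀, rfl⟩ := Finset.mem_image.1 hf
      obtain ⟨p, hp, rfl⟩ : ∃ p ∈ vertexPairs, {σ p.1, σ p.2} = e := by
        obtain ⟨x, y, hxy, rfl⟩ := Finset.card_eq_two.1 he
        have hne : σ.symm x ≠ σ.symm y := by simpa using hxy
        rcases lt_or_gt_of_ne hne with h | h
        · exact ⟨(σ.symm x, σ.symm y), mem_vertexPairs.2 h, by simp⟩
        · exact ⟨(σ.symm y, σ.symm x), mem_vertexPairs.2 h, by simp [Finset.pair_comm]⟩
      have hcount := card_filter_image_eq_pairCount hA σ p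
      have hF2 := hF.2.2.1 _ he ⟨g, hg, heg⟩
      have hpos : 0 < pairCount A p := by
        rw [← hcount]
        exact card_pos.2 ⟨_, mem_filter.2 ⟨hf, hef⟩⟩
      have hp1 := hclosed p hp
      have heq := Finset.eq_of_subset_of_card_le
        (Finset.filter_subset_filter (fun f => {σ p.1, σ p.2} ⊆ f) hsub) (by omega)
      have : g ∈ F.filter (fun f => {σ p.1, σ p.2} ⊆ f) := mem_filter.2 ⟨hg, heg⟩
      rw [← heq] at this
      exact (mem_filter.1 this).1
  have hlen : A.length = 10 := by
    rw [← List.toFinset_card_of_nodup hA, ← hF.card_eq_ten, ← himage,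
      Finset.card_image_of_injective _ (image_image_perm_injective σ)]
  have hcov : ∀ v, ∃ f ∈ A, v ∈ f := by
    intro v
    obtain ⟨g, hg, hvg⟩ := hF.2.1 (σ v)
    rw [← himage] at hg
    obtain ⟨f, hf, rfl⟩ := Finset.mem_image.1 hg
    exact ⟨f, by simpa using hf, by simpa using hvg⟩
  obtain ⟨i, ρ, hρ⟩ := checkClosed_sound hcheck hlen hcov
  refine ⟨i, .of_perm himage (ρ := ρ) (Finset.eq_of_subset_of_card_le ?_ ?_)⟩
  · simpa [Finset.image_subset_iff] using hρ
  · rw [card_modelFaces, Finset.card_image_of_injective _ (image_image_perm_injective ρ),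
      List.toFinset_card_of_nodup hA, hlen]

/-- Across an edge contained in only one of the faces found so far there is another face,
and its third vertex may be taken to be among the used vertices or the first unused one. -/
theorem exists_face_across {F : Finset (Finset (Fin 7))} (hF : IsSphereTriangulation 7 F)
    {k : ℕ} {A : List (Finset (Fin 7))} {σ : Equiv.Perm (Fin 7)}
    (hA : A.Nodup) (hk : ∀ f ∈ A, ∀ v ∈ f, v.val < k) (hσ : ∀ f ∈ A, f.image σ ∈ F)
    {e : Fin 7 × Fin 7} (he : e.1 < e.2) (hcount : pairCount A e = 1) :
    e.1.val < k ∧ e.2.val < k ∧ ∃ y : Fin 7, y.val ≤ k ∧ y ≠ e.1 ∧ y ≠ e.2 ∧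
      {e.1, e.2, y} ∉ A ∧
      ∃ τ : Equiv.Perm (Fin 7), ∀ f ∈ {e.1, e.2, y} :: A, f.image τ ∈ F := by
  obtain ⟨f₀, hf₀, hmem⟩ : ∃ f ∈ A, e.1 ∈ f ∧ e.2 ∈ f := by
    have : 0 < pairCount A e := by omega
    simpa [pairCount, List.countP_pos_iff] using this
  have hk1 := hk f₀ hf₀ _ hmem.1
  have hk2 := hk f₀ hf₀ _ hmem.2
  refine ⟨hk1, hk2, ?_⟩
  have hcard : ({σ e.1, σ e.2} : Finset (Fin 7)).card = 2 :=
    card_pair (σ.injective.ne he.ne)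
  have hF2 := hF.2.2.1 _ hcard ⟨_, hσ f₀ hf₀, by
    simp [insert_subset_iff, hmem]⟩
  have hA1 := card_filter_image_eq_pairCount hA σ e
  obtain ⟨g, hg, hgA⟩ := Finset.exists_mem_notMem_of_card_lt_card
    (s := (A.toFinset.image (fun f => f.image σ)).filter (fun f => {σ e.1, σ e.2} ⊆ f))
    (t := F.filter (fun f => {σ e.1, σ e.2} ⊆ f)) (by omega)
  obtain ⟨hgF, hge⟩ := mem_filter.1 hg
  obtain ⟨z, hz1, hz2, rfl⟩ : ∃ z, z ≠ e.1 ∧ z ≠ e.2 ∧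
      g = ({e.1, e.2, z} : Finset _).image σ := by
    have hsd : (g \ {σ e.1, σ e.2}).card = 1 := by
      rw [card_sdiff_of_subset hge, hF.1 g hgF, hcard]
    obtain ⟨x, hx⟩ := card_eq_one.1 hsd
    have hxg : x ∈ g \ {σ e.1, σ e.2} := hx ▸ mem_singleton_self x
    simp only [mem_sdiff, mem_insert, mem_singleton, not_or] at hxg
    refine ⟨σ.symm x, ?_, ?_, ?_⟩
    · rw [Ne, Equiv.symm_apply_eq]; exact hxg.2.1
    · rw [Ne, Equiv.symm_apply_eq]; exact hxg.2.2
    · rw [← sdiff_union_of_subset hge, hx]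
      ext; simp; tauto
  have hznot : {e.1, e.2, z} ∉ A := fun h => hgA
    (mem_filter.2 ⟨mem_image_of_mem _ (by simpa using h), hge⟩)
  by_cases hzk : z.val < k
  · refine ⟨z, hzk.le, hz1, hz2, hznot, σ, ?_⟩
    simpa using ⟨by simpa using hgF, hσ⟩
  · have hk7 : k < 7 := by omega
    have hfix : ∀ v : Fin 7, v.val < k → Equiv.swap ⟨k, hk7⟩ z v = v := fun v hv =>
      Equiv.swap_apply_of_ne_of_ne (by rintro rfl; simp at hv) (by rintro rfl; exact hzk hv)
    refine ⟨⟨k, hk7⟩, le_rfl, ?_, ?_, ?_, (Equiv.swap ⟨k, hk7⟩ z).trans σ, ?_⟩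
    · rintro h; simp [← h] at hk1
    · rintro h; simp [← h] at hk2
    · intro h
      exact absurd (hk _ h ⟨k, hk7⟩ (by simp)) (by simp)
    · intro f hf
      rcases List.mem_cons.1 hf with rfl | hf
      · simpa [image_insert, hfix _ hk1, hfix _ hk2] using hgF
      · convert hσ f hf using 1
        exact Finset.image_congr fun v hv => by simp [hfix v (hk f hf v hv)]

theorem exists_triIso_of_searchFaces {F : Finset (Finset (Fin 7))} (hF : IsSphereTriangulation 7 F)
    {n k : ℕ} {A : List (Finset (Fin 7))} {σ : Equiv.Perm (Fin 7)}
    (hlen : A.length + n = 10) (hA : A.Nodup) (hne : A ≠ [])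
    (hk : ∀ f ∈ A, ∀ v ∈ f, v.val < k) (hσ : ∀ f ∈ A, f.image σ ∈ F)
    (hsearch : searchFaces n k A = true) : ∃ i, TriIso 7 F (modelFaces i).toFinset := by
  induction n generalizing k A σ with
  | zero =>
    unfold searchFaces at hsearch
    split at hsearch
    next hnone =>
      exact exists_triIso_of_checkClosed hF hA hne hσ
        (by simpa [-Prod.forall] using hnone) hsearch
    next e hsome =>
      have hcount : pairCount A e = 1 := by simpa using List.find?_some hsome
      obtain ⟨-, -, y, -, -, -, hy, τ, hτ⟩ := exists_face_across hF hA hk hσ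
        (mem_vertexPairs.1 (List.mem_of_find?_eq_some hsome)) hcount
      have hle : ((({e.1, e.2, y} :: A).toFinset).image (fun f => f.image τ)).card ≤ F.card :=
        card_le_card (by simpa [-List.toFinset_cons, Finset.image_subset_iff] using hτ)
      rw [Finset.card_image_of_injective _ (image_image_perm_injective τ),
        List.toFinset_card_of_nodup (List.nodup_cons.2 ⟨hy, hA⟩), hF.card_eq_ten,
        List.length_cons] at hle
      omega
  | succ n ih =>
    unfold searchFaces at hsearch
    split at hsearch
    next hnone =>
      exact exists_triIso_of_checkClosed hF hA hne hσ
        (by simpa [-Prod.forall] using hnone) hsearch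
    next e hsome =>
      have hcount : pairCount A e = 1 := by simpa using List.find?_some hsome
      obtain ⟨hk1, hk2, y, hyk, hy1, hy2, hy, τ, hτ⟩ := exists_face_across hF hA hk hσ
        (mem_vertexPairs.1 (List.mem_of_find?_eq_some hsome)) hcount
      have hnd : ({e.1, e.2, y} :: A).Nodup := List.nodup_cons.2 ⟨hy, hA⟩
      have hcount2 : ∀ p ∈ vertexPairs, pairCount ({e.1, e.2, y} :: A) p ≤ 2 := by
        intro p hp
        rw [← card_filter_image_eq_pairCount hnd τ p]
        have hsub : ({e.1, e.2, y} :: A).toFinset.image (fun f => f.image τ) ⊆ F := by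
          simpa [-List.toFinset_cons, Finset.image_subset_iff] using hτ
        by_cases hex : ∃ f ∈ F, {τ p.1, τ p.2} ⊆ f
        · rw [← hF.2.2.1 {τ p.1, τ p.2}
            (card_pair (τ.injective.ne (mem_vertexPairs.1 hp).ne)) hex]
          exact card_le_card (filter_subset_filter _ hsub)
        · rw [filter_eq_empty_iff.2 fun f hf hpf => hex ⟨f, hsub hf, hpf⟩]
          simp
      have hany : vertexPairs.any (2 < pairCount ({e.1, e.2, y} :: A) ·) = false := by
        simpa [-Prod.forall] using hcount2
      have hrec := List.all_eq_true.1 hsearch y (List.mem_finRange y)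
      simp only [hany, hy, beq_eq_false_iff_ne.2 hy1, beq_eq_false_iff_ne.2 hy2,
        decide_eq_false (not_lt.2 hyk), decide_false, Bool.false_or] at hrec
      refine ih (by simp only [List.length_cons]; omega) hnd (by simp) ?_ hτ hrec
      intro f hf v hv
      rcases List.mem_cons.1 hf with rfl | hf
      · simp only [mem_insert, mem_singleton] at hv
        rcases hv with rfl | rfl | rfl <;> split <;> omega
      · have := hk f hf v hv
        split <;> omega

theorem exists_perm_image_eq {α : Type*} [Fintype α] [DecidableEq α] {s t : Finset α}
    (h : s.card = t.card) : ∃ σ : Equiv.Perm α, s.image σ = t := by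
  let e : {x // x ∈ s} ≃ {x // x ∈ t} := Finset.equivOfCardEq h
  refine ⟨e.extendSubtype, Finset.eq_of_subset_of_card_le ?_ ?_⟩
  · exact Finset.image_subset_iff.2 fun x hx => e.extendSubtype_mem x hx
  · rw [Finset.card_image_of_injective _ (Equiv.injective _), h]

theorem IsSphereTriangulation.exists_triIso_modelFaces {F : Finset (Finset (Fin 7))}
    (hF : IsSphereTriangulation 7 F) : ∃ i, TriIso 7 F (modelFaces i).toFinset := by
  obtain ⟨f, hf, -⟩ := hF.2.1 0
  obtain ⟨σ, hσ⟩ := exists_perm_image_eq (s := ({0, 1, 2} : Finset (Fin 7))) (t := f)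
    (by rw [hF.1 f hf]; rfl)
  refine exists_triIso_of_searchFaces hF (n := 9) (k := 3) (A := [{0, 1, 2}]) (σ := σ) rfl
    (List.nodup_singleton _) (List.cons_ne_nil _ _) ?_ ?_ (by decide +kernel)
  · simp
  · simpa [hσ] using hf

/-- The vertices reachable from `S` in at most `m` steps of a relation. -/
def reach (R : Fin 7 → Fin 7 → Bool) : ℕ → List (Fin 7) → List (Fin 7)
  | 0, S => S
  | m + 1, S => reach R m (S ++ (List.finRange 7).filter fun y => S.any fun x => R x y)

theorem reflTransGen_of_mem_reach {R : Fin 7 → Fin 7 → Bool} {a b : Fin 7} {m : ℕ}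
    {S : List (Fin 7)} (hS : ∀ x ∈ S, Relation.ReflTransGen (fun x y => R x y = true) a x)
    (hb : b ∈ reach R m S) : Relation.ReflTransGen (fun x y => R x y = true) a b := by
  induction m generalizing S with
  | zero => exact hS b hb
  | succ m ih =>
    refine ih (fun x hx => ?_) hb
    rcases List.mem_append.1 hx with hx | hx
    · exact hS x hx
    · simp only [List.mem_filter, List.any_eq_true] at hx
      obtain ⟨-, y, hy, hR⟩ := hx
      exact (hS y hy).tail hR

theorem link_reach (i : Fin 5) : ∀ v a b : Fin 7,
    (∃ f ∈ modelFaces i, v ∈ f ∧ a ∈ f) → (∃ f ∈ modelFaces i, v ∈ f ∧ b ∈ f) →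
      a ≠ v → b ≠ v → b ∈ reach (fun x y => {v, x, y} ∈ modelFaces i) 3 [a] := by
  revert i
  decide +kernel

theorem skeleton_reach (i : Fin 5) : ∀ a b : Fin 7,
    b ∈ reach (fun x y => (modelFaces i).any fun f => x ∈ f ∧ y ∈ f) 3 [a] := by
  revert i
  decide +kernel

theorem isSphereTriangulation_modelFaces (i : Fin 5) :
    IsSphereTriangulation 7 (modelFaces i).toFinset := by
  have h3 : ∀ f ∈ (modelFaces i).toFinset, f.card = 3 := by
    revert i; decide +kernel
  have h2 : ∀ e : Finset (Fin 7), e.card = 2 → (∃ f ∈ (modelFaces i).toFinset, e ⊆ f) →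
      ((modelFaces i).toFinset.filter (fun f => e ⊆ f)).card = 2 := by
    revert i; decide +kernel
  refine ⟨h3, by revert i; decide +kernel, h2, ?_, ?_, ?_⟩
  · intro v a b ha hb hav hbv
    have := reflTransGen_of_mem_reach (a := a) (by simp [Relation.ReflTransGen.refl])
      (link_reach i v a b (by simpa using ha) (by simpa using hb) hav hbv)
    simpa using this
  · intro a b
    have := reflTransGen_of_mem_reach (a := a) (by simp [Relation.ReflTransGen.refl])
      (skeleton_reach i a b)
    simpa using this
  · have h := three_mul_card_eq_two_mul_card_triEdges h3 h2
    rw [card_modelFaces] at h ⊢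
    push_cast
    omega

theorem TriIso.faceDegrees_eq {n : ℕ} {F G : Finset (Finset (Fin n))} (h : TriIso n F G) :
    (univ.val.map fun v => (F.filter (v ∈ ·)).card) =
      univ.val.map fun v => (G.filter (v ∈ ·)).card := by
  obtain ⟨σ, rfl⟩ := h
  have hcard : ∀ v, ((F.image fun f => f.image σ).filter (σ v ∈ ·)).card =
      (F.filter (v ∈ ·)).card := by
    intro v
    rw [Finset.filter_image, Finset.card_image_of_injective _ (image_injective σ.injective)]
    simp
  have huniv : (univ.val.map σ : Multiset (Fin n)) = univ.val := by
    simp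
  conv_rhs => rw [← huniv, Multiset.map_map]
  exact Multiset.map_congr rfl fun v _ => (hcard v).symm

theorem not_triIso_modelFaces : ∀ i j, i ≠ j →
    ¬ TriIso 7 (modelFaces i).toFinset (modelFaces j).toFinset := by
  have hinj : ∀ i j : Fin 5, i ≠ j →
    (univ.val.map fun v => ((modelFaces i).toFinset.filter (v ∈ ·)).card) ≠
      univ.val.map fun v => ((modelFaces j).toFinset.filter (v ∈ ·)).card := by
    decide +kernel
  exact fun i j hij h => hinj i j hij h.faceDegrees_eq

/-- Up to simplicial isomorphism there are exactly five triangulations of the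
2-sphere with `7` vertices. -/
theorem five_sphere_triangulations_seven_vertices :
    ∃ Fs : Fin 5 → Finset (Finset (Fin 7)),
      (∀ i, IsSphereTriangulation 7 (Fs i)) ∧
      (∀ i j, i ≠ j → ¬ TriIso 7 (Fs i) (Fs j)) ∧
      (∀ F : Finset (Finset (Fin 7)), IsSphereTriangulation 7 F →
        ∃ i, TriIso 7 F (Fs i)) := by
  exact ⟨fun i => (modelFaces i).toFinset, isSphereTriangulation_modelFaces,
    not_triIso_modelFaces, fun _ hF => hF.exists_triIso_modelFaces⟩
end
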